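/- arXiv:math/0310431 — 2 statements merged into one kernel-verified Lean document; each statement's English description precedes it below -/
import Mathlib

section
/- Let f : ℂ^n → ℂ be a holomorphic function with a nondegenerate critical point (Morse point) at the origin, i.e. f has vanishing derivative at 0 and the complex Hessian of f at 0 is an invertible bilinear form. Then the Poincaré–Hopf index at 0 of the real vector field on ℂ^n ≅ ℝ^{2n} given by the conjugate gradient v(z) = conj(∇f(z)) equals (-1)^n. -/
open Complex Metric in
/-- Directional derivatives of an entire function of several complex variables are continuous. -/
theorem Differentiable.continuous_fderiv_apply_complex {E : Type*} [NormedAddCommGroup E]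
    [NormedSpace ℂ E] {f : E → ℂ} (hf : Differentiable ℂ f) (v : E) :
    Continuous fun z => fderiv ℂ f z v := by
  have key : ∀ z, fderiv ℂ f z v =
      (2 * Real.pi * I : ℂ)⁻¹ • ∮ w in C(0, 1), ((w - 0) ^ 2)⁻¹ • f (z + w • v) := by
    intro z
    have hline : ∀ w : ℂ, HasDerivAt (fun w : ℂ => z + w • v) v w := fun w => by
      simpa using ((hasDerivAt_id w).smul_const v).const_add z
    have hd : ∀ w : ℂ, HasDerivAt (fun w : ℂ => f (z + w • v)) (fderiv ℂ f (z + w • v) v) w :=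
      fun w => (hf _).hasFDerivAt.comp_hasDerivAt w (hline w)
    rw [two_pi_I_inv_smul_circleIntegral_sub_sq_inv_smul_of_differentiable isOpen_univ
      (Set.subset_univ _) (fun w _ => (hd w).differentiableAt.differentiableWithinAt)
      (mem_ball_self one_pos), (hd 0).deriv]
    simp
  suffices h : Continuous fun z => ∮ w in C(0, 1), ((w - 0) ^ 2)⁻¹ • f (z + w • v) by
    rw [funext key]
    exact h.const_smul (2 * Real.pi * I : ℂ)⁻¹
  simp only [circleIntegral]
  refine intervalIntegral.continuous_parametric_intervalIntegral_of_continuous' ?_ _ _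
  have hne : ∀ p : E × ℝ, (circleMap 0 1 p.2 - 0) ^ 2 ≠ 0 := fun p => by
    simp [circleMap]
  have hinv : Continuous fun p : E × ℝ => ((circleMap 0 1 p.2 - 0) ^ 2)⁻¹ :=
    (((continuous_circleMap 0 1).comp continuous_snd).sub continuous_const |>.pow 2).inv₀ hne
  have hc : Continuous fun p : E × ℝ => circleMap 0 1 p.2 :=
    (continuous_circleMap 0 1).comp continuous_snd
  have hcont := hf.continuous
  simp only [deriv_circleMap, Function.uncurry_def]
  exact (hc.mul continuous_const).smul
    (hinv.smul (hcont.comp (continuous_fst.add (hc.smul continuous_const))))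

/-- An injective operator on a finite-dimensional complex space is joined to the identity by a
path of operators in their complex linear span that are uniformly bounded below. -/
theorem ContinuousLinearMap.exists_path_to_id_bounded_below {E : Type*} [NormedAddCommGroup E]
    [NormedSpace ℂ E] [FiniteDimensional ℂ E] [Nontrivial E] (B : E →L[ℂ] E)
    (hB : Function.Injective B) :
    ∃ γ : ℝ → ℂ, Continuous γ ∧ γ 0 = 0 ∧ γ 1 = 1 ∧ ∃ c > 0, ∀ t ∈ Set.Icc (0 : ℝ) 1, ∀ z,
      c * ‖z‖ ≤ ‖(1 - γ t) • B z + γ t • z‖ := by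
  let S : Set ℂ := {s | ∃ z ≠ 0, (1 - s) • B z + s • z = 0}
  have hS : S.Countable := by
    refine ((Module.End.finite_hasEigenvalue (B : E →ₗ[ℂ] E)).image
      fun μ => μ / (μ - 1)).countable.mono ?_
    rintro s ⟨z, hz, hs⟩
    have hs1 : s - 1 ≠ 0 := by
      intro h
      obtain rfl : s = 1 := sub_eq_zero.mp h
      simp [hz] at hs
    have hBz : B z = (s / (s - 1)) • z := by
      have h : (s - 1) • B z = s • z := by
        rw [← sub_eq_zero, ← neg_eq_zero, ← hs]
        module
      rw [div_eq_inv_mul, mul_smul, ← h, inv_smul_smul₀ hs1]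
    refine ⟨s / (s - 1), Module.End.hasEigenvalue_of_hasEigenvector
      (Module.End.hasEigenvector_iff.mpr ⟨Module.End.mem_eigenspace_iff.mpr hBz, hz⟩), ?_⟩
    have : s / (s - 1) - 1 = 1 / (s - 1) := by field_simp; ring
    simp only [this]
    field_simp
  have h0 : (0 : ℂ) ∈ Sᶜ := by
    rintro ⟨z, hz, h⟩
    exact hz (hB (by simpa using h))
  have h1 : (1 : ℂ) ∈ Sᶜ := by
    rintro ⟨z, hz, h⟩
    exact hz (by simpa using h)
  have hrank : 1 < Module.rank ℝ ℂ := by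
    rw [Complex.rank_real_complex]; exact Nat.one_lt_ofNat
  obtain ⟨p, hp⟩ := (hS.isPathConnected_compl_of_one_lt_rank hrank).joinedIn 0 h0 1 h1
  have hpc : Continuous p.extend := p.continuous_extend
  have hpS : ∀ t, p.extend t ∉ S := fun t => hp _
  refine ⟨p.extend, hpc, p.extend_zero, p.extend_one, ?_⟩
  have : ProperSpace E := FiniteDimensional.proper ℂ E
  have hcont : Continuous fun q : ℝ × E =>
      ‖(1 - p.extend q.1) • B q.2 + p.extend q.1 • q.2‖ := by fun_prop
  obtain ⟨⟨t₀, z₀⟩, ⟨-, hz₀⟩, hmin⟩ :=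
    (isCompact_Icc.prod (isCompact_sphere (0 : E) 1)).exists_isMinOn
      (((Set.nonempty_Icc.mpr zero_le_one).prod
        (NormedSpace.sphere_nonempty.mpr zero_le_one)) :
        (Set.Icc (0 : ℝ) 1 ×ˢ Metric.sphere (0 : E) 1).Nonempty) hcont.continuousOn
  have hz₀' : z₀ ≠ 0 := ne_zero_of_mem_unit_sphere ⟨z₀, hz₀⟩
  refine ⟨_, norm_pos_iff.mpr fun h => hpS t₀ ⟨z₀, hz₀', h⟩, fun t ht z => ?_⟩
  rcases eq_or_ne z 0 with rfl | hz
  · simp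
  have hnz : ‖z‖ ≠ 0 := norm_ne_zero_iff.mpr hz
  have hmem : ((‖z‖⁻¹ : ℝ) : ℂ) • z ∈ Metric.sphere (0 : E) 1 := by
    simp [norm_smul, hnz]
  have hle := isMinOn_iff.mp hmin (t, ((‖z‖⁻¹ : ℝ) : ℂ) • z) ⟨ht, hmem⟩
  have heq : (1 - p.extend t) • B (((‖z‖⁻¹ : ℝ) : ℂ) • z) + p.extend t • ((‖z‖⁻¹ : ℝ) : ℂ) • z =
      ((‖z‖⁻¹ : ℝ) : ℂ) • ((1 - p.extend t) • B z + p.extend t • z) := by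
    rw [map_smul]; module
  simp only [heq] at hle
  rw [norm_smul ((‖z‖⁻¹ : ℝ) : ℂ), Complex.norm_real, norm_inv, norm_norm, inv_mul_eq_div,
    le_div_iff₀ (norm_pos_iff.mpr hz)] at hle
  exact hle

/-- The linear functionals on `ℂ^n`, identified with their coordinate vectors. -/
noncomputable def EuclideanSpace.dualCoords (n : ℕ) :
    (EuclideanSpace ℂ (Fin n) →L[ℂ] ℂ) →L[ℂ] EuclideanSpace ℂ (Fin n) :=
  ((EuclideanSpace.equiv (Fin n) ℂ).symm : (Fin n → ℂ) →L[ℂ] EuclideanSpace ℂ (Fin n)) ∘L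
    ContinuousLinearMap.pi fun i =>
      ContinuousLinearMap.apply ℂ ℂ (EuclideanSpace.single i (1 : ℂ))

theorem EuclideanSpace.dualCoords_apply {n : ℕ} (l : EuclideanSpace ℂ (Fin n) →L[ℂ] ℂ)
    (i : Fin n) : dualCoords n l i = l (EuclideanSpace.single i 1) := rfl

theorem EuclideanSpace.dualCoords_injective (n : ℕ) : Function.Injective (dualCoords n) := by
  intro l m h
  refine ContinuousLinearMap.coe_injective
    ((EuclideanSpace.basisFun (Fin n) ℂ).toBasis.ext fun i => ?_)
  have := congrArg (fun v : EuclideanSpace ℂ (Fin n) => v i) h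
  simpa [dualCoords_apply] using this

theorem EuclideanSpace.gradient_apply {n : ℕ} (f : EuclideanSpace ℂ (Fin n) → ℂ)
    (z : EuclideanSpace ℂ (Fin n)) (i : Fin n) :
    gradient f z i = starRingEnd ℂ (dualCoords n (fderiv ℂ f z) i) := by
  have h : inner ℂ (gradient f z) (EuclideanSpace.single i (1 : ℂ)) =
      fderiv ℂ f z (EuclideanSpace.single i 1) := by
    rw [gradient, InnerProductSpace.toDual_symm_apply]
  rw [dualCoords_apply, ← h, EuclideanSpace.inner_single_right]
  simp

/-- The Poincaré–Hopf index at `0` of the conjugate-gradient vector field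
`v(z) = conj(∇ f(z))` (which is Mathlib's `gradient f` for the Hermitian inner product)
of a holomorphic function with a Morse point at the origin equals `(-1)^n`.
This is expressed, equivalently, by saying that on all sufficiently small spheres
around `0` the vector field is nonvanishing and homotopic, through nonvanishing maps,
to the componentwise conjugation map `z ↦ conj z`, the standard model of degree `(-1)^n`
on `ℂ^n ≅ ℝ^{2n}`. -/
theorem stmt0 (n : ℕ) (hn : 0 < n) (f : EuclideanSpace ℂ (Fin n) → ℂ)
    (hf : Differentiable ℂ f)
    (hcrit : fderiv ℂ f 0 = 0)
    (hhess : Function.Bijective fun x => fderiv ℂ (fderiv ℂ f) 0 x) :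
    ∃ ε > 0, ∀ r : ℝ, 0 < r → r ≤ ε →
      (∀ z ∈ Metric.sphere (0 : EuclideanSpace ℂ (Fin n)) r, gradient f z ≠ 0) ∧
      ∃ H : ℝ × EuclideanSpace ℂ (Fin n) → EuclideanSpace ℂ (Fin n),
        Continuous H ∧
        (∀ z ∈ Metric.sphere (0 : EuclideanSpace ℂ (Fin n)) r, H (0, z) = gradient f z) ∧
        (∀ z ∈ Metric.sphere (0 : EuclideanSpace ℂ (Fin n)) r,
          H (1, z) = fun i => starRingEnd ℂ (z i)) ∧
        (∀ t ∈ Set.Icc (0:ℝ) 1, ∀ z ∈ Metric.sphere (0 : EuclideanSpace ℂ (Fin n)) r,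
          H (t, z) ≠ 0) := by
  have : Nonempty (Fin n) := ⟨⟨0, hn⟩⟩
  set Φ := EuclideanSpace.dualCoords n
  have hdiff : DifferentiableAt ℂ (fderiv ℂ f) 0 := by
    by_contra h
    rw [fderiv_zero_of_not_differentiableAt h] at hhess
    obtain ⟨z, hz⟩ := exists_ne (0 : EuclideanSpace ℂ (Fin n))
    exact hz (hhess.injective (by simp))
  let B : EuclideanSpace ℂ (Fin n) →L[ℂ] EuclideanSpace ℂ (Fin n) :=
    Φ ∘L fderiv ℂ (fderiv ℂ f) 0
  let g : EuclideanSpace ℂ (Fin n) → EuclideanSpace ℂ (Fin n) := fun z => Φ (fderiv ℂ f z)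
  have hBinj : Function.Injective B :=
    (EuclideanSpace.dualCoords_injective n).comp hhess.injective
  have hgcont : Continuous g :=
    (EuclideanSpace.equiv (Fin n) ℂ).symm.continuous.comp
      (continuous_pi fun i => hf.continuous_fderiv_apply_complex (EuclideanSpace.single i 1))
  have hg : HasFDerivAt g B 0 := Φ.hasFDerivAt.comp 0 hdiff.hasFDerivAt
  obtain ⟨γ, hγ, hγ0, hγ1, c, hc, hbound⟩ := B.exists_path_to_id_bounded_below hBinj
  obtain ⟨δ, hδ, hsmall⟩ := Metric.eventually_nhds_iff.mp
    (hg.isLittleO.def (half_pos hc))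
  let conj : EuclideanSpace ℂ (Fin n) → EuclideanSpace ℂ (Fin n) :=
    fun z => WithLp.toLp 2 fun i => starRingEnd ℂ (z i)
  have hconj : Continuous conj := by
    refine (PiLp.continuous_toLp 2 _).comp (continuous_pi fun i => ?_)
    exact Complex.continuous_conj.comp (by fun_prop)
  have hconj0 : ∀ z, z ≠ 0 → conj z ≠ 0 := by
    intro z hz h
    refine hz (PiLp.ext fun i => ?_)
    have := congrArg (fun v : EuclideanSpace ℂ (Fin n) => v i) h
    simpa [conj] using this
  let H : ℝ × EuclideanSpace ℂ (Fin n) → EuclideanSpace ℂ (Fin n) := fun q =>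
    conj ((1 - γ q.1) • B q.2 + γ q.1 • q.2 + ((1 - q.1 : ℝ) : ℂ) • (g q.2 - B q.2))
  have hH : Continuous H := hconj.comp (by fun_prop)
  have hH0 : ∀ z, H (0, z) = gradient f z := by
    intro z
    refine PiLp.ext fun i => ?_
    rw [EuclideanSpace.gradient_apply]
    simp [H, conj, hγ0, g, Φ]
  have hH1 : ∀ z, H (1, z) = conj z := by
    intro z
    simp [H, hγ1]
  have hne : ∀ r, 0 < r → r ≤ δ / 2 → ∀ t ∈ Set.Icc (0 : ℝ) 1,
      ∀ z ∈ Metric.sphere (0 : EuclideanSpace ℂ (Fin n)) r, H (t, z) ≠ 0 := by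
    intro r hr hrδ t ht z hz
    have hzr : ‖z‖ = r := by simpa using hz
    refine hconj0 _ fun h => ?_
    have hrem : ‖g z - B z‖ ≤ c / 2 * ‖z‖ := by
      have hg0 : g 0 = 0 := by simp [g, hcrit]
      have := hsmall (y := z) (by rw [dist_zero_right, hzr]; linarith)
      simpa [hg0] using this
    have hscal : ‖((1 - t : ℝ) : ℂ) • (g z - B z)‖ ≤ c / 2 * ‖z‖ := by
      rw [norm_smul, Complex.norm_real, Real.norm_of_nonneg (by linarith [ht.2])]
      exact (mul_le_of_le_one_left (norm_nonneg _) (by linarith [ht.1])).trans hrem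
    have hlow := hbound t ht z
    rw [eq_neg_of_add_eq_zero_left h, norm_neg, hzr] at hlow
    rw [hzr] at hscal
    nlinarith [mul_pos hc hr]
  refine ⟨δ / 2, half_pos hδ, fun r hr hrδ => ⟨fun z hz => ?_, H, hH, fun z _ => hH0 z,
    fun z _ => ?_, hne r hr hrδ⟩⟩
  · rw [← hH0 z]
    exact hne r hr hrδ 0 (by simp) z hz
  · rw [hH1]
end

section
/- Let Y ⊆ ℂ^N be a (real-)algebraic set, viewed as a semialgebraic subset of ℝ^{2N}, whose regular locus is a smooth submanifold M. Then there exists M₀ ∈ ℝ such that for every R ≥ M₀, the sphere S_R of radius R centered at the origin is transverse to M, i.e. the function x ↦ ‖x‖² restricted to M has no critical points on M ∩ {‖x‖ = R} for R ≥ M₀. -/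
open TensorProduct in
theorem exists_derivation_ne_zero_of_transcendental {k K : Type*} [Field k] [Field K] [CharZero k]
    [Algebra k K] {T : K} (hT : Transcendental k T) : ∃ D : Derivation k K K, D T ≠ 0 := by
  classical
  have hs : AlgebraicIndepOn k id ({T} : Set K) := by
    rw [AlgebraicIndepOn]
    exact (algebraicIndependent_unique_type_iff).2 hT
  obtain ⟨t, hTt, ht⟩ := exists_isTranscendenceBasis_superset hs
  let A := MvPolynomial t k
  let _ : Algebra A K := (MvPolynomial.aeval ((↑) : t → K)).toAlgebra
  have hA : ∀ p : A, algebraMap A K p = MvPolynomial.aeval ((↑) : t → K) p := fun _ => rfl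
  have : IsScalarTower k A K := .of_algebraMap_eq fun r => by rw [hA]; simp [A]
  have : FaithfulSMul A K := (faithfulSMul_iff_algebraMap_injective A K).2 ht.1
  let _ := FractionRing.liftAlgebra A K
  have : Algebra.IsAlgebraic A K := by
    have := ht.isAlgebraic
    refine ⟨fun x => ?_⟩
    obtain ⟨p, hp, hx⟩ := this.isAlgebraic x
    refine ⟨p.map ht.1.aevalEquiv.symm.toRingHom, ?_, ?_⟩
    · rwa [Ne, Polynomial.map_eq_zero_iff]
      exact ht.1.aevalEquiv.symm.injective
    · have hcomp : (algebraMap A K).comp ht.1.aevalEquiv.symm.toRingHom =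
          algebraMap (Algebra.adjoin k (Set.range ((↑) : t → K))) K := by
        ext y
        obtain ⟨q, rfl⟩ := ht.1.aevalEquiv.surjective y
        simp [hA]
      rw [Polynomial.aeval_def, Polynomial.eval₂_map]
      exact hcomp ▸ hx
  have : Algebra.IsAlgebraic (FractionRing A) K :=
    (IsFractionRing.comap_isAlgebraic_iff (A := A)).1 inferInstance
  have : CharZero (FractionRing A) := charZero_of_injective_algebraMap (algebraMap k _).injective
  have : Algebra.FormallyEtale (FractionRing A) K := Algebra.FormallyEtale.of_isSeparable _ K
  have : Algebra.FormallyEtale A (FractionRing A) := .of_isLocalization (nonZeroDivisors A)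
  have : Algebra.FormallyEtale A K := .comp _ (FractionRing A) _
  let i : t := ⟨T, hTt rfl⟩
  let d : Derivation k A K := MvPolynomial.mkDerivation k (Pi.single i 1)
  let e := KaehlerDifferential.tensorKaehlerEquivOfFormallyEtale k A K
  let l : Ω[K⁄k] →ₗ[K] K := (d.liftKaehlerDifferential.liftBaseChange K) ∘ₗ e.symm.toLinearMap
  refine ⟨l.compDer (KaehlerDifferential.D k K), ?_⟩
  have h1 : T = algebraMap A K (MvPolynomial.X i) := by rw [hA]; simp [i]
  have : l (KaehlerDifferential.D k K T) = 1 := by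
    rw [h1]
    simp [l, e, KaehlerDifferential.tensorKaehlerEquivOfFormallyEtale_symm_D_algebraMap, d, A]
  simp [this]

/-- If `q` is transcendental modulo a prime ideal `I` of a polynomial ring in characteristic zero,
some polynomial vector field preserves `I` but does not send `q` into `I`. -/
theorem exists_derivation_map_le_of_transcendental {k σ : Type*} [Field k] [CharZero k] [Finite σ]
    (I : Ideal (MvPolynomial σ k)) [I.IsPrime] {q : MvPolynomial σ k}
    (hq : Transcendental k (Ideal.Quotient.mk I q)) :
    ∃ X : Derivation k (MvPolynomial σ k) (MvPolynomial σ k), (∀ p ∈ I, X p ∈ I) ∧ X q ∉ I := by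
  let B := MvPolynomial σ k ⧸ I
  let K := FractionRing B
  have hinj : Function.Injective (algebraMap B K) := IsFractionRing.injective B K
  obtain ⟨D, hD⟩ := exists_derivation_ne_zero_of_transcendental (K := K)
    ((transcendental_algebraMap_iff hinj).2 hq)
  let π : MvPolynomial σ k →ₐ[k] K := (Algebra.ofId B K).restrictScalars k |>.comp
    (Ideal.Quotient.mkₐ k I)
  have hπ : ∀ p, π p = 0 ↔ p ∈ I := fun p => by
    rw [← Ideal.Quotient.eq_zero_iff_mem, ← map_eq_zero_iff _ hinj]; rfl
  obtain ⟨b, hb⟩ := IsLocalization.exist_integer_multiples_of_finite (nonZeroDivisors B)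
    (fun i => D (π (MvPolynomial.X i)))
  choose f hf using hb
  choose g hg using fun i => Ideal.Quotient.mk_surjective (I := I) (f i)
  let X := MvPolynomial.mkDerivation k g
  have hX : ∀ p, π (X p) = algebraMap B K b * D (π p) := by
    intro p
    induction p using MvPolynomial.induction_on with
    | C a =>
      have : π (MvPolynomial.C a) = algebraMap k K a := π.commutes a
      simp [X, this]
    | add p q hp hq => simp [hp, hq, mul_add]
    | mul_X p i hp =>
      have : π (X (MvPolynomial.X i)) = algebraMap B K b * D (π (MvPolynomial.X i)) := by
        rw [← Algebra.smul_def]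
        refine Eq.trans ?_ (hf i)
        simp only [X, MvPolynomial.mkDerivation_X, ← hg]; rfl
      simp only [Derivation.leibniz, map_add, smul_eq_mul, map_mul, hp, this]
      ring
  refine ⟨X, fun p hp => ?_, fun h => ?_⟩
  · rw [← hπ, hX, (hπ p).2 hp]; simp
  · rw [← hπ, hX, mul_eq_zero, map_eq_zero_iff _ hinj] at h
    exact h.elim (nonZeroDivisors.ne_zero b.2) hD

open Filter Topology

theorem eventually_eq_zero_of_hasDerivAt_clm {F : Type*} [NormedAddCommGroup F] [NormedSpace ℝ F]
    {L : ℝ → F →L[ℝ] F} {w : ℝ → F} {t₀ : ℝ} (hL : ContinuousAt L t₀)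
    (hw : ∀ᶠ t in 𝓝 t₀, HasDerivAt w (L t (w t)) t) (h0 : w t₀ = 0) : ∀ᶠ t in 𝓝 t₀, w t = 0 := by
  have hK : ∀ᶠ t in 𝓝 t₀, ‖L t‖₊ < ‖L t₀‖₊ + 1 :=
    hL.nnnorm.eventually_lt_const (lt_add_one _)
  refine ODE_solution_unique_of_eventually (v := fun t => L t) (s := fun _ => Set.univ)
    (K := ‖L t₀‖₊ + 1) (g := 0) ?_ (hw.mono fun t ht => ⟨ht, trivial⟩)
    (Eventually.of_forall fun t => ⟨?_, trivial⟩) h0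
  · filter_upwards [hK] with t ht
    exact ((L t).lipschitz.weaken ht.le).lipschitzOnWith
  · simp [Pi.zero_def, hasDerivAt_const]

namespace MvPolynomial

theorem hasDerivAt_eval_of_derivation {σ : Type*}
    (X : Derivation ℝ (MvPolynomial σ ℝ) (MvPolynomial σ ℝ))
    {γ : ℝ → σ → ℝ} {t : ℝ}
    (hγ : ∀ i, HasDerivAt (fun s => γ s i) (eval (γ t) (X (MvPolynomial.X i))) t)
    (p : MvPolynomial σ ℝ) : HasDerivAt (fun s => eval (γ s) p) (eval (γ t) (X p)) t := by
  induction p using MvPolynomial.induction_on with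
  | C a =>
    have : X (C a) = 0 := X.map_algebraMap a
    simp [this, hasDerivAt_const]
  | add p q hp hq => simpa using! hp.add hq
  | mul_X p i hp =>
    have := hp.mul (hγ i)
    simp only [Derivation.leibniz, smul_eq_mul, map_add, map_mul, eval_X]
    convert! this using 1
    ring

theorem contDiff_eval {σ : Type*} [Fintype σ] {n : WithTop ℕ∞} (p : MvPolynomial σ ℝ) :
    ContDiff ℝ n fun x : σ → ℝ => eval x p := by
  induction p using MvPolynomial.induction_on with
  | C a => simpa using contDiff_const
  | add p q hp hq => simpa using hp.add hq
  | mul_X p i hp => simpa using hp.mul (contDiff_apply ℝ ℝ i)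

/-- The flow of a polynomial vector field preserving an ideal `I` preserves its zero locus. -/
theorem exists_curve_of_derivation {σ : Type*} [Fintype σ] {I : Ideal (MvPolynomial σ ℝ)}
    (X : Derivation ℝ (MvPolynomial σ ℝ) (MvPolynomial σ ℝ)) (hX : ∀ p ∈ I, X p ∈ I)
    {x : σ → ℝ} (hx : ∀ p ∈ I, eval x p = 0) :
    ∃ γ : ℝ → σ → ℝ, γ 0 = x ∧ (∀ p, HasDerivAt (fun t => eval (γ t) p) (eval x (X p)) 0) ∧
      ∀ᶠ t in 𝓝 0, ∀ p ∈ I, eval (γ t) p = 0 := by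
  have hf : ContDiffAt ℝ 1 (fun y i => eval y (X (MvPolynomial.X i)) : (σ → ℝ) → σ → ℝ) x :=
    contDiffAt_pi.2 fun i => (contDiff_eval _).contDiffAt
  obtain ⟨γ, h0, ε, hε, hγ⟩ :=
    hf.exists_forall_mem_closedBall_exists_eq_forall_mem_Ioo_hasDerivAt₀ 0
  have hmem : Set.Ioo (0 - ε) (0 + ε) ∈ 𝓝 (0 : ℝ) := Ioo_mem_nhds (by simpa) (by simpa)
  have hd : ∀ᶠ t in 𝓝 (0 : ℝ), ∀ p, HasDerivAt (fun t => eval (γ t) p) (eval (γ t) (X p)) t := by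
    filter_upwards [hmem] with t ht p
    exact hasDerivAt_eval_of_derivation X (hasDerivAt_pi.1 (hγ t ht)) p
  refine ⟨γ, h0, fun p => h0 ▸ hd.self_of_nhds p, ?_⟩
  obtain ⟨m, g, rfl⟩ := Submodule.fg_iff_exists_fin_generating_family.1 (IsNoetherian.noetherian I)
  have hg : ∀ j, g j ∈ Submodule.span (MvPolynomial σ ℝ) (Set.range g) :=
    fun j => Submodule.subset_span ⟨j, rfl⟩
  choose a ha using fun j =>
    (Submodule.mem_span_range_iff_exists_fun (MvPolynomial σ ℝ)).1 (hX _ (hg j))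
  let L : ℝ → (Fin m → ℝ) →L[ℝ] (Fin m → ℝ) := fun t =>
    ∑ j, ∑ l, eval (γ t) (a j l) • (ContinuousLinearMap.proj l).smulRight (Pi.single j 1)
  have hL : ContinuousAt L 0 := by
    have hc : ∀ p, ContinuousAt (fun t => eval (γ t) p) 0 :=
      fun p => (hd.self_of_nhds p).continuousAt
    fun_prop
  have hw : ∀ᶠ t in 𝓝 (0 : ℝ), (fun j => eval (γ t) (g j)) = 0 := by
    refine eventually_eq_zero_of_hasDerivAt_clm hL ?_ ?_
    · filter_upwards [hd] with t ht
      refine hasDerivAt_pi.2 fun j => ?_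
      convert! ht (g j) using 1
      simp [L, ← ha j, Finset.sum_apply, Pi.single_apply]
    · ext j
      simpa [h0] using hx _ (hg j)
  filter_upwards [hw] with t ht p hp
  obtain ⟨c, rfl⟩ := Submodule.mem_span_range_iff_exists_fun (MvPolynomial σ ℝ) |>.1 hp
  simp only [smul_eq_mul, map_sum, map_mul]
  exact Finset.sum_eq_zero fun j _ => by rw [congrFun ht j]; simp

end MvPolynomial

/-- The polynomials vanishing at `x k` for `l`-almost all `k`. -/
def ultrafilterVanishingIdeal {κ σ : Type*} (l : Ultrafilter κ) (x : κ → σ → ℝ) :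
    Ideal (MvPolynomial σ ℝ) where
  carrier := {p | ∀ᶠ k in l, MvPolynomial.eval (x k) p = 0}
  add_mem' hp hq := by filter_upwards [hp, hq] with k h₁ h₂; simp [h₁, h₂]
  zero_mem' := by simp
  smul_mem' c p hp := by filter_upwards [hp] with k h; simp [h]

section ultrafilterVanishingIdeal

variable {κ σ : Type*} {l : Ultrafilter κ} {x : κ → σ → ℝ}

theorem mem_ultrafilterVanishingIdeal {p : MvPolynomial σ ℝ} :
    p ∈ ultrafilterVanishingIdeal l x ↔ ∀ᶠ k in l, MvPolynomial.eval (x k) p = 0 :=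
  Iff.rfl

instance ultrafilterVanishingIdeal_isPrime : (ultrafilterVanishingIdeal l x).IsPrime where
  ne_top' := by
    rw [Ideal.ne_top_iff_one, mem_ultrafilterVanishingIdeal]
    simpa using l.neBot.ne
  mem_or_mem' {p q} h := by
    simp only [mem_ultrafilterVanishingIdeal, map_mul, mul_eq_zero] at h ⊢
    exact Ultrafilter.eventually_or.1 h

theorem eventually_forall_mem_ultrafilterVanishingIdeal [Finite σ] :
    ∀ᶠ k in l, ∀ p ∈ ultrafilterVanishingIdeal l x, MvPolynomial.eval (x k) p = 0 := by
  obtain ⟨s, hs⟩ := IsNoetherian.noetherian (ultrafilterVanishingIdeal l x)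
  have : ∀ᶠ k in l, ∀ p ∈ s, MvPolynomial.eval (x k) p = 0 :=
    (Filter.eventually_all_finset s).2 fun p hp =>
      mem_ultrafilterVanishingIdeal.1 (hs ▸ Submodule.subset_span hp)
  filter_upwards [this] with k hk
  have : ultrafilterVanishingIdeal l x ≤ RingHom.ker (MvPolynomial.eval (x k)) := by
    rw [← hs]
    exact Ideal.span_le.2 hk
  exact fun p hp => this hp

theorem transcendental_mk_ultrafilterVanishingIdeal {q : MvPolynomial σ ℝ}
    (hq : Tendsto (fun k => MvPolynomial.eval (x k) q) l atTop) :
    Transcendental ℝ (Ideal.Quotient.mk (ultrafilterVanishingIdeal l x) q) := by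
  rintro ⟨f, hf, h⟩
  have h' : Polynomial.aeval q f ∈ ultrafilterVanishingIdeal l x := by
    rw [← Ideal.Quotient.eq_zero_iff_mem, ← h]
    exact (Polynomial.aeval_algHom_apply (Ideal.Quotient.mkₐ ℝ _) q f).symm
  have hne := hq.eventually (Polynomial.eventually_atTop_not_isRoot f hf)
  obtain ⟨k, h₁, h₂⟩ := ((mem_ultrafilterVanishingIdeal.1 h').and hne).exists
  apply h₂
  rw [Polynomial.IsRoot, ← h₁, ← MvPolynomial.coe_aeval_eq_eval, RingHom.coe_coe,
    ← Polynomial.aeval_algHom_apply, Polynomial.coe_aeval_eq_eval]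

end ultrafilterVanishingIdeal

/-- Outside a large enough ball, every point of a real algebraic set has a curve through it,
lying in the set, whose velocity is not tangent to the sphere centred at the origin. -/
theorem exists_forall_norm_ge_exists_transverse_curve {σ : Type*} [Fintype σ]
    (S : Set (MvPolynomial σ ℝ)) :
    ∃ r : ℝ, ∀ x : EuclideanSpace ℝ σ, (∀ p ∈ S, MvPolynomial.eval (fun i => x i) p = 0) →
      r ≤ ‖x‖ → ∃ (γ : ℝ → EuclideanSpace ℝ σ) (v : EuclideanSpace ℝ σ), γ 0 = x ∧
        (∀ᶠ t in 𝓝 0, ∀ p ∈ S, MvPolynomial.eval (fun i => γ t i) p = 0) ∧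
        HasDerivAt γ v 0 ∧ inner (𝕜 := ℝ) x v ≠ 0 := by
  by_contra! hcon
  choose x hxS hxr hx using fun k : ℕ => hcon k
  let l := hyperfilter ℕ
  let y : ℕ → σ → ℝ := fun k i => x k i
  let I := ultrafilterVanishingIdeal l y
  let q : MvPolynomial σ ℝ := ∑ i, MvPolynomial.X i ^ 2
  have hq : Tendsto (fun k => MvPolynomial.eval (y k) q) l atTop := by
    have : ∀ k, MvPolynomial.eval (y k) q = ‖x k‖ ^ 2 := fun k => by
      simp [q, y, EuclideanSpace.norm_sq_eq]
    simp only [this]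
    exact (tendsto_pow_atTop two_ne_zero).comp
      ((tendsto_atTop_mono hxr tendsto_natCast_atTop_atTop).mono_left Nat.hyperfilter_le_atTop)
  obtain ⟨X, hXI, hXq⟩ := exists_derivation_map_le_of_transcendental I
    (transcendental_mk_ultrafilterVanishingIdeal hq)
  have hXq' : ∀ᶠ k in l, MvPolynomial.eval (y k) (X q) ≠ 0 :=
    Ultrafilter.eventually_not.2 hXq
  obtain ⟨k, hkI, hkq⟩ :=
    ((eventually_forall_mem_ultrafilterVanishingIdeal (l := l) (x := y)).and hXq').exists
  obtain ⟨γ, h0, hγ, hγI⟩ := MvPolynomial.exists_curve_of_derivation X hXI hkI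
  have hSI : S ⊆ I := fun p hp => Eventually.of_forall fun k => hxS k p hp
  let v : EuclideanSpace ℝ σ :=
    WithLp.toLp 2 fun i => MvPolynomial.eval (y k) (X (MvPolynomial.X i))
  refine hkq ?_
  have hv : MvPolynomial.eval (y k) (X q) = 2 * inner ℝ (x k) v := by
    simp [q, y, v, PiLp.inner_apply, Finset.mul_sum, Derivation.leibniz_pow]
    refine Finset.sum_congr rfl fun i _ => by ring
  rw [hv, hx k (fun t => WithLp.toLp 2 (γ t)) v, mul_zero]
  · simp [h0, y]
  · filter_upwards [hγI] with t ht p hp using ht p (hSI hp)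
  · have : HasDerivAt γ v.ofLp 0 :=
      hasDerivAt_pi.2 fun i => by simpa [v] using hγ (MvPolynomial.X i)
    exact (PiLp.continuousLinearEquiv 2 ℝ (fun _ : σ => ℝ)).symm.hasFDerivAt.comp_hasDerivAt 0 this

/-- Milnor-type finiteness: for a real algebraic set `Y ⊆ ℝ^{2N}` (the zero set of a
finite family of real polynomials), with `M` its regular locus (the set of points near
which `Y` is a smooth submanifold, cut out by a smooth submersion), all sufficiently
large spheres centered at the origin are transverse to `M`: at every point `x ∈ M` with
`‖x‖ = R ≥ M₀` there is a tangent vector `v` to `M` at `x` (velocity of a curve in `M`)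
with `⟪x, v⟫ ≠ 0`, i.e. `‖·‖²|_M` has no critical point on `M ∩ S_R`. -/
theorem stmt2 (N : ℕ) (S : Finset (MvPolynomial (Fin (2 * N)) ℝ))
    (Y : Set (EuclideanSpace ℝ (Fin (2 * N))))
    (hY : Y = {x | ∀ p ∈ S, MvPolynomial.eval (fun i => x i) p = 0})
    (M : Set (EuclideanSpace ℝ (Fin (2 * N))))
    (hM : M = {x | x ∈ Y ∧ ∃ (m : ℕ) (U : Set (EuclideanSpace ℝ (Fin (2 * N))))
      (φ : EuclideanSpace ℝ (Fin (2 * N)) → EuclideanSpace ℝ (Fin m)),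
      IsOpen U ∧ x ∈ U ∧ ContDiff ℝ (⊤ : ℕ∞) φ ∧ (∀ y ∈ U, (y ∈ Y ↔ φ y = 0)) ∧
      ∀ y ∈ U, Function.Surjective (fderiv ℝ φ y)}) :
    ∃ M₀ : ℝ, ∀ R ≥ M₀, ∀ x ∈ M, ‖x‖ = R →
      ∃ (γ : ℝ → EuclideanSpace ℝ (Fin (2 * N))) (v : EuclideanSpace ℝ (Fin (2 * N))),
        (∀ t, γ t ∈ M) ∧ γ 0 = x ∧ HasDerivAt γ v 0 ∧ inner (𝕜 := ℝ) x v ≠ 0 := by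
  obtain ⟨r, hr⟩ := exists_forall_norm_ge_exists_transverse_curve (SetLike.coe S)
  refine ⟨r, fun R hR x hx hxR => ?_⟩
  have hxY : x ∈ Y := (hM ▸ hx).1
  obtain ⟨γ, v, h0, hγ, hv, hxv⟩ := hr x (by simpa [hY] using! hxY) (hxR ▸ hR)
  have hγM : ∀ᶠ t in 𝓝 0, γ t ∈ M := by
    rw [hM] at hx
    obtain ⟨-, m, U, φ, hU, hxU, hφ⟩ := hx
    filter_upwards [hγ, hv.continuousAt.eventually (hU.mem_nhds (h0 ▸ hxU))] with t ht htU
    rw [hM]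
    exact ⟨by rw [hY]; exact ht, m, U, φ, hU, htU, hφ⟩
  classical
  refine ⟨fun t => if γ t ∈ M then γ t else x, v, fun t => ?_, by simp [h0], ?_, hxv⟩
  · dsimp only
    split_ifs with h
    exacts [h, hx]
  · refine hv.congr_of_eventuallyEq ?_
    filter_upwards [hγM] with t ht using if_pos ht
end
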